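/- arXiv:2603.17422 — 6 statements merged into one kernel-verified Lean document; each statement's English description precedes it below -/
import Mathlib

section
/- Let (X_n)_{n≥0} be a time-inhomogeneous Markov chain on a Polish space 𝒳 with one-step kernels (K_n)_{n∈ℤ}, and let (μ_n)_{n∈ℤ} be an invariant measure family with X_k distributed as μ_k for every k≥0. Assume there exist M̃>0 and α∈(0,1) such that ‖P(i,x,j,·) − μ_j‖_TV ≤ M̃ α^{j−i}(1+V(x)) for all i≤j and x∈𝒳, and assume S := sup_{n≥0} ∫(1+V) dμ_n < ∞. Then for every bounded measurable g:𝒳→ℝ and every n≥1, Var(Σ_{k=0}^{n-1} g(X_k)) ≤ 2n‖g‖_∞² + n·2Cα/(1−α), where C := ‖g‖_∞²·M̃·S; in particular Var(Σ_{k=0}^{n-1} g(X_k)) = O(n). -/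
open MeasureTheory ProbabilityTheory Filter
open scoped ENNReal NNReal

noncomputable section

/-- The σ-algebra generated by `X 0, …, X n` (the past of the process up to time `n`). -/
def pastSA {Ω S : Type*} [MeasurableSpace S] (X : ℕ → Ω → S) (n : ℕ) :
    MeasurableSpace Ω :=
  ⨆ i : Fin (n + 1), MeasurableSpace.comap (X i) inferInstance

/-- `X` is a time-inhomogeneous Markov chain under `Pr` with one-step transition law
`Q n` from time `n` to time `n + 1`, i.e. `Pr(X_{n+1} ∈ A ∣ X_0,…,X_n) = Q n (X n) A` a.s. -/
def IsInhomMarkov {Ω S : Type*} [MeasurableSpace Ω] [MeasurableSpace S]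
    (Pr : Measure Ω) (X : ℕ → Ω → S) (Q : ℕ → S → Measure S) : Prop :=
  (∀ n, Measurable (X n)) ∧
  ∀ (n : ℕ) (A : Set S), MeasurableSet A → ∀ B : Set Ω, MeasurableSet[pastSA X n] B →
    Pr (B ∩ X (n + 1) ⁻¹' A) = ∫⁻ ω in B, Q n (X n ω) A ∂Pr

/-- `nstep K m j x = P(m, x, m + j, ·)`, the `j`-step transition law started from `x`
at time `m`, obtained by composing the one-step kernels `K (m+1), …, K (m+j)`. -/
def nstep {S : Type*} [MeasurableSpace S] (K : ℤ → S → Measure S) (m : ℤ) :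
    ℕ → S → Measure S
  | 0 => fun x => Measure.dirac x
  | (j + 1) => fun x => (nstep K m j x).bind (K (m + j + 1))

/-- Total variation distance.  For probability measures `μ, ν` this equals
`‖μ − ν‖_TV = sup_{‖φ‖_∞ ≤ 1} |∫ φ dμ − ∫ φ dν| = 2 ⨆ A (μ(A) − ν(A))`. -/
def tvDist {S : Type*} [MeasurableSpace S] (μ ν : Measure S) : ℝ :=
  2 * ⨆ A : {s : Set S // MeasurableSet s}, ((μ A.1).toReal - (ν A.1).toReal)

/-- The transition law `nstep K m j` as a kernel. -/
def stepKernel {S : Type*} [MeasurableSpace S] (K : ℤ → Kernel S S) (m : ℤ) : ℕ → Kernel S S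
  | 0 => Kernel.id
  | (j + 1) => K (m + j + 1) ∘ₖ stepKernel K m j

lemma stepKernel_apply {S : Type*} [MeasurableSpace S] (K : ℤ → Kernel S S) (m : ℤ) (j : ℕ)
    (x : S) : stepKernel K m j x = nstep (fun k => ⇑(K k)) m j x := by
  induction j with
  | zero => exact Kernel.id_apply x
  | succ j ih => rw [stepKernel, Kernel.comp_apply, nstep, ih]

lemma isMarkovKernel_stepKernel {S : Type*} [MeasurableSpace S] (K : ℤ → Kernel S S)
    (hK : ∀ n, IsMarkovKernel (K n)) (m : ℤ) (j : ℕ) : IsMarkovKernel (stepKernel K m j) := by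
  induction j with
  | zero => exact inferInstanceAs (IsMarkovKernel Kernel.id)
  | succ j ih =>
    have := hK (m + j + 1)
    exact inferInstanceAs (IsMarkovKernel (K (m + j + 1) ∘ₖ stepKernel K m j))

lemma abs_measureReal_sub_le_tvDist {S : Type*} [MeasurableSpace S] (P Q : Measure S)
    [IsProbabilityMeasure P] [IsProbabilityMeasure Q] {A : Set S} (hA : MeasurableSet A) :
    |P.real A - Q.real A| ≤ tvDist P Q / 2 := by
  have key : ∀ B : Set S, MeasurableSet B → P.real B - Q.real B ≤ tvDist P Q / 2 := by
    intro B hB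
    rw [tvDist, mul_div_cancel_left₀ _ (two_ne_zero' ℝ)]
    refine le_ciSup (f := fun A : {s : Set S // MeasurableSet s} =>
      (P A.1).toReal - (Q A.1).toReal) ⟨1, ?_⟩ ⟨B, hB⟩
    rintro _ ⟨C, rfl⟩
    have h1 : P.real C.1 ≤ 1 := measureReal_le_one
    have h2 : 0 ≤ Q.real C.1 := measureReal_nonneg
    simp only [measureReal_def] at h1 h2
    dsimp only
    linarith
  have h1 := key A hA
  have h2 := key Aᶜ hA.compl
  rw [probReal_compl_eq_one_sub hA, probReal_compl_eq_one_sub hA] at h2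
  rw [abs_le]
  constructor <;> linarith

lemma integrable_of_abs_le {S : Type*} [MeasurableSpace S] (P : Measure S) [IsFiniteMeasure P]
    {g : S → ℝ} (hg : Measurable g) {M : ℝ} (hM : ∀ x, |g x| ≤ M) : Integrable g P :=
  Integrable.of_bound hg.aestronglyMeasurable M (ae_of_all _ hM)

lemma abs_integral_sub_le_tvDist {S : Type*} [MeasurableSpace S] (P Q : Measure S)
    [IsProbabilityMeasure P] [IsProbabilityMeasure Q] {g : S → ℝ} (hg : Measurable g) {M : ℝ}
    (hM0 : 0 ≤ M) (hM : ∀ x, |g x| ≤ M) :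
    |∫ x, g x ∂P - ∫ x, g x ∂Q| ≤ M * tvDist P Q := by
  have cake : ∀ ν : Measure S, IsProbabilityMeasure ν →
      (∫ x, g x ∂ν) + M = ∫ t in Set.Ioc 0 (2 * M), ν.real {a | t ≤ g a + M} := by
    intro ν _
    have hint := integrable_of_abs_le ν hg hM
    rw [← (hint.add (integrable_const M)).integral_eq_integral_Ioc_meas_le
      (f := fun x => g x + M)]
    · rw [integral_add hint (integrable_const M)]
      simp
    · exact ae_of_all _ fun x => by have := (abs_le.mp (hM x)).1; simp only [Pi.zero_apply]; linarith
    · exact ae_of_all _ fun x => by have := (abs_le.mp (hM x)).2; dsimp only; linarith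
  have hint : ∀ ν : Measure S, IsProbabilityMeasure ν →
      IntegrableOn (fun t => ν.real {a | t ≤ g a + M}) (Set.Ioc 0 (2 * M)) := by
    intro ν _
    refine Integrable.of_bound (C := 1) (Measurable.aestronglyMeasurable ?_) (ae_of_all _ fun t => ?_)
    · exact Antitone.measurable fun s t hst => measureReal_mono fun a ha => le_trans hst ha
    · rw [Real.norm_of_nonneg measureReal_nonneg]
      exact measureReal_le_one
  have e : ∫ x, g x ∂P - ∫ x, g x ∂Q = ∫ t in Set.Ioc 0 (2 * M),
      (P.real {a | t ≤ g a + M} - Q.real {a | t ≤ g a + M}) := by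
    rw [integral_sub (hint P ‹_›) (hint Q ‹_›), ← cake P ‹_›, ← cake Q ‹_›]
    ring
  rw [e, ← Real.norm_eq_abs]
  refine (norm_setIntegral_le_of_norm_le_const (C := tvDist P Q / 2) measure_Ioc_lt_top fun t _ =>
    abs_measureReal_sub_le_tvDist P Q
      (measurableSet_le measurable_const (hg.add_const M))).trans_eq ?_
  rw [Real.volume_real_Ioc_of_le (by linarith)]
  ring

lemma pastSA_mono {Ω S : Type*} [MeasurableSpace S] (X : ℕ → Ω → S) : Monotone (pastSA X) := by
  intro m n hmn
  exact iSup_le fun i => le_iSup (fun i : Fin (n + 1) => MeasurableSpace.comap (X i) inferInstance)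
    (⟨i, by omega⟩ : Fin (n + 1))

lemma pastSA_le {Ω S : Type*} [mΩ : MeasurableSpace Ω] [MeasurableSpace S] {X : ℕ → Ω → S}
    (hX : ∀ n, Measurable (X n)) (n : ℕ) : pastSA X n ≤ mΩ :=
  iSup_le fun i => (hX i).comap_le

lemma measurableSet_pastSA_preimage {Ω S : Type*} [MeasurableSpace S] (X : ℕ → Ω → S) (n : ℕ)
    {A : Set S} (hA : MeasurableSet A) : MeasurableSet[pastSA X n] (X n ⁻¹' A) :=
  le_iSup (fun i : Fin (n + 1) => MeasurableSpace.comap (X i) inferInstance) (Fin.last n) _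
    ⟨A, hA, rfl⟩

section Chain

variable {Ω S : Type*} [MeasurableSpace Ω] [MeasurableSpace S] {Pr : Measure Ω}
  {K : ℤ → Kernel S S} {X : ℕ → Ω → S}

lemma IsInhomMarkov.map_restrict_eq_bind
    (hX : IsInhomMarkov Pr X (fun n x => K ((n : ℤ) + 1) x)) (k m : ℕ) {B : Set Ω}
    (hB : MeasurableSet[pastSA X k] B) :
    (Pr.restrict B).map (X (k + m)) = ((Pr.restrict B).map (X k)).bind (stepKernel K k m) := by
  have hBm : MeasurableSet B := pastSA_le hX.1 k _ hB
  induction m with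
  | zero => exact (Measure.id_comp (μ := (Pr.restrict B).map (X k))).symm
  | succ m ih =>
    have h : (Pr.restrict B).map (X (k + m + 1)) =
        ((Pr.restrict B).map (X (k + m))).bind (K (k + m + 1)) := by
      ext A hA
      rw [Measure.map_apply (hX.1 _) hA, Measure.restrict_apply (hX.1 _ hA), Set.inter_comm,
        hX.2 (k + m) A hA B (pastSA_mono X (Nat.le_add_right k m) _ hB),
        Measure.bind_apply hA (Kernel.aemeasurable _),
        lintegral_map (Kernel.measurable_coe _ hA) (hX.1 _)]
      push_cast
      rfl
    rw [← add_assoc, h, ih, Measure.bind_bind (Kernel.aemeasurable _) (Kernel.aemeasurable _)]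
    rfl

lemma IsInhomMarkov.map_pair_eq_compProd [IsProbabilityMeasure Pr]
    (hX : IsInhomMarkov Pr X (fun n x => K ((n : ℤ) + 1) x))
    (hK : ∀ n, IsMarkovKernel (K n)) (k m : ℕ) :
    Pr.map (fun ω => (X k ω, X (k + m) ω)) = (Pr.map (X k)) ⊗ₘ stepKernel K k m := by
  have := isMarkovKernel_stepKernel K hK k m
  have hp : Measurable fun ω => (X k ω, X (k + m) ω) := (hX.1 k).prodMk (hX.1 (k + m))
  have := Measure.isProbabilityMeasure_map (μ := Pr) hp.aemeasurable
  have := Measure.isProbabilityMeasure_map (μ := Pr) (hX.1 k).aemeasurable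
  refine Measure.ext_prod fun {s t} hs ht => ?_
  have h := congrArg (fun ν : Measure S => ν t)
    (hX.map_restrict_eq_bind k m (measurableSet_pastSA_preimage X k hs))
  rw [Measure.map_apply (hX.1 _) ht, Measure.restrict_apply (hX.1 _ ht),
    Measure.bind_apply ht (Kernel.aemeasurable _), ← Measure.restrict_map (hX.1 k) hs] at h
  rw [Measure.map_apply hp (hs.prod ht), Measure.compProd_apply_prod hs ht, ← h, Set.inter_comm]
  rfl

end Chain

lemma sum_pow_sub_le {α : ℝ} (hα0 : 0 ≤ α) (hα1 : α < 1) (n : ℕ) :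
    ∑ k ∈ Finset.range n, α ^ (n - k) ≤ α / (1 - α) := by
  induction n with
  | zero => simpa using div_nonneg hα0 (sub_nonneg.mpr hα1.le)
  | succ n ih =>
    have h : ∑ k ∈ Finset.range n, α ^ (n + 1 - k) = α * ∑ k ∈ Finset.range n, α ^ (n - k) := by
      rw [Finset.mul_sum]
      refine Finset.sum_congr rfl fun k hk => ?_
      rw [Nat.sub_add_comm (Finset.mem_range.mp hk).le, pow_succ']
    rw [Finset.sum_range_succ, h, Nat.add_sub_cancel_left, pow_one]
    have h1 : α / (1 - α) = α * (α / (1 - α)) + α := by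
      have : 1 - α ≠ 0 := by linarith
      field_simp
      ring
    rw [h1]
    gcongr

lemma sum_sum_le_of_geometric {c : ℕ → ℕ → ℝ} (hsymm : ∀ k l, c k l = c l k) {D C α : ℝ}
    (hα0 : 0 ≤ α) (hα1 : α < 1) (hC : 0 ≤ C) (hdiag : ∀ k, c k k ≤ D)
    (hoff : ∀ k m, c k (k + m) ≤ C * α ^ m) (n : ℕ) :
    ∑ k ∈ Finset.range n, ∑ l ∈ Finset.range n, c k l ≤ n * (D + 2 * (C * (α / (1 - α)))) := by
  induction n with
  | zero => simp
  | succ n ih =>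
    have h : ∑ k ∈ Finset.range n, c k n ≤ C * (α / (1 - α)) :=
      calc ∑ k ∈ Finset.range n, c k n ≤ ∑ k ∈ Finset.range n, C * α ^ (n - k) := by
            refine Finset.sum_le_sum fun k hk => ?_
            have := hoff k (n - k)
            rwa [Nat.add_sub_cancel' (Finset.mem_range.mp hk).le] at this
        _ ≤ C * (α / (1 - α)) := by
            rw [← Finset.mul_sum]
            exact mul_le_mul_of_nonneg_left (sum_pow_sub_le hα0 hα1 n) hC
    have h' : ∑ l ∈ Finset.range n, c n l = ∑ k ∈ Finset.range n, c k n :=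
      Finset.sum_congr rfl fun l _ => hsymm n l
    simp only [Finset.sum_range_succ, Finset.sum_add_distrib]
    rw [h']
    have := hdiag n
    push_cast
    linarith

/-- **Variance bound**: under the exponential ergodicity bound
`‖P(i,x,j,·) − μ_j‖_TV ≤ M̃ α^{j−i}(1 + V(x))` and a uniform `(1+V)`-moment bound `S`
on the invariant family, `Var(Σ_{k<n} g(X_k)) ≤ 2n‖g‖_∞² + n·2Cα/(1−α)` with
`C = ‖g‖_∞²·M̃·S`; in particular the variance is `O(n)`. -/
theorem variance_bound
    {𝒳 : Type*} [MeasurableSpace 𝒳] [TopologicalSpace 𝒳] [PolishSpace 𝒳] [BorelSpace 𝒳]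
    {Ω : Type*} [MeasurableSpace Ω] (Pr : Measure Ω) [IsProbabilityMeasure Pr]
    -- the one-step Markov kernels
    (K : ℤ → Kernel 𝒳 𝒳) (hK : ∀ n, IsMarkovKernel (K n))
    -- the chain
    (X : ℕ → Ω → 𝒳)
    (hX : IsInhomMarkov Pr X (fun n x => K ((n : ℤ) + 1) x))
    (V : 𝒳 → ℝ≥0∞) (hV : Measurable V)
    -- the invariant measure family, which carries the laws of the chain
    (μ : ℤ → Measure 𝒳) (hμ : ∀ n, IsProbabilityMeasure (μ n))
    (hinv : ∀ (m : ℤ) (j : ℕ), (μ m).bind (nstep (fun k => ⇑(K k)) m j) = μ (m + j))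
    (hXlaw : ∀ k : ℕ, Measure.map (X k) Pr = μ (k : ℤ))
    -- exponential ergodicity in total variation
    (Mt α : ℝ) (hM : 0 < Mt) (hα0 : 0 < α) (hα1 : α < 1)
    (herg : ∀ (i : ℤ) (m : ℕ) (x : 𝒳),
      ENNReal.ofReal (tvDist (nstep (fun k => ⇑(K k)) i m x) (μ (i + m)))
        ≤ ENNReal.ofReal (Mt * α ^ m) * (1 + V x))
    -- `S`, the uniform `(1+V)`-moment of the invariant family, is finite
    (S : ℝ≥0∞) (hSdef : S = ⨆ n : ℕ, ∫⁻ x, (1 + V x) ∂(μ (n : ℤ))) (hS : S < ⊤)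
    -- a bounded measurable function
    (g : 𝒳 → ℝ) (hg : Measurable g) (Mg : ℝ) (hMg : ∀ x, |g x| ≤ Mg) :
    ∀ n : ℕ, 1 ≤ n →
      (∫ ω, (∑ k ∈ Finset.range n, g (X k ω)) ^ 2 ∂Pr)
          - (∫ ω, ∑ k ∈ Finset.range n, g (X k ω) ∂Pr) ^ 2
        ≤ 2 * n * Mg ^ 2 + n * (2 * (Mg ^ 2 * Mt * S.toReal) * α / (1 - α)) := by
  intro n _
  have hX1 := hX.1
  have hMg0 : 0 ≤ Mg := by
    obtain ⟨ω⟩ := Pr.nonempty_of_neZero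
    exact (abs_nonneg _).trans (hMg (X 0 ω))
  have hC0 : 0 ≤ Mg ^ 2 * Mt * S.toReal := by positivity
  have hY : ∀ k, Measurable fun ω => g (X k ω) := fun k => hg.comp (hX1 k)
  have hL : ∀ k, MemLp (fun ω => g (X k ω)) 2 Pr := fun k =>
    MemLp.of_bound (hY k).aestronglyMeasurable Mg (ae_of_all _ fun ω => hMg _)
  have hdiag : ∀ k, cov[fun ω => g (X k ω), fun ω => g (X k ω); Pr] ≤ Mg ^ 2 := by
    intro k
    rw [covariance_self (hY k).aemeasurable]
    refine (variance_le_sq_of_bounded (a := -Mg) (b := Mg)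
      (ae_of_all _ fun ω => abs_le.mp (hMg _)) (hY k).aemeasurable).trans_eq ?_
    ring
  have hoff : ∀ k m, cov[fun ω => g (X k ω), fun ω => g (X (k + m) ω); Pr]
      ≤ Mg ^ 2 * Mt * S.toReal * α ^ m := by
    intro k m
    have := hμ k
    have := hμ (k + m)
    have := isMarkovKernel_stepKernel K hK k m
    have hPg : Measurable fun x => ∫ y, g y ∂(stepKernel K k m x) :=
      hg.stronglyMeasurable.integral_kernel.measurable
    have hPgM : ∀ x, |∫ y, g y ∂(stepKernel K k m x)| ≤ Mg := fun x => by
      simpa using norm_integral_le_of_norm_le_const (μ := stepKernel K k m x)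
        (f := g) (C := Mg) (ae_of_all _ hMg)
    have hprod : ∫ ω, g (X k ω) * g (X (k + m) ω) ∂Pr
        = ∫ x, g x * ∫ y, g y ∂(stepKernel K k m x) ∂(μ k) := by
      have hgg : Measurable fun p : 𝒳 × 𝒳 => g p.1 * g p.2 :=
        (hg.comp measurable_fst).mul (hg.comp measurable_snd)
      rw [← integral_map (f := fun p : 𝒳 × 𝒳 => g p.1 * g p.2)
        ((hX1 k).prodMk (hX1 (k + m))).aemeasurable hgg.aestronglyMeasurable,
        hX.map_pair_eq_compProd hK k m, hXlaw k, Measure.integral_compProd]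
      · simp only [integral_const_mul]
      · refine integrable_of_abs_le _ hgg (M := Mg * Mg) fun p => ?_
        rw [abs_mul]
        exact mul_le_mul (hMg _) (hMg _) (abs_nonneg _) hMg0
    have hmean : ∀ j : ℕ, ∫ ω, g (X j ω) ∂Pr = ∫ x, g x ∂(μ j) := by
      intro j
      rw [← hXlaw j, integral_map (hX1 j).aemeasurable hg.aestronglyMeasurable]
    have hcov : cov[fun ω => g (X k ω), fun ω => g (X (k + m) ω); Pr]
        = ∫ x, g x * (∫ y, g y ∂(stepKernel K k m x) - ∫ y, g y ∂(μ (k + m))) ∂(μ k) := by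
      rw [covariance_eq_sub (hL k) (hL (k + m))]
      simp only [Pi.mul_apply, mul_sub]
      rw [hprod, hmean k, hmean (k + m), integral_sub, integral_mul_const]
      · push_cast
        rfl
      · refine integrable_of_abs_le _ (hg.mul hPg) (M := Mg * Mg) fun x => ?_
        rw [abs_mul]
        exact mul_le_mul (hMg _) (hPgM _) (abs_nonneg _) hMg0
      · exact (integrable_of_abs_le _ hg hMg).mul_const _
    have hbound : ∀ x, ‖g x * (∫ y, g y ∂(stepKernel K k m x) - ∫ y, g y ∂(μ (k + m)))‖ₑ
        ≤ ENNReal.ofReal (Mg ^ 2 * (Mt * α ^ m)) * (1 + V x) := by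
      intro x
      have htv := abs_integral_sub_le_tvDist (stepKernel K k m x) (μ (k + m)) hg hMg0 hMg
      have he := herg k m x
      rw [← stepKernel_apply] at he
      have h1 : |g x * (∫ y, g y ∂(stepKernel K k m x) - ∫ y, g y ∂(μ (k + m)))|
          ≤ Mg ^ 2 * tvDist (stepKernel K k m x) (μ (k + m)) := by
        rw [abs_mul, pow_two, mul_assoc]
        exact mul_le_mul (hMg x) htv (abs_nonneg _) hMg0
      rw [← ofReal_norm, Real.norm_eq_abs]
      refine (ENNReal.ofReal_le_ofReal h1).trans ?_
      rw [ENNReal.ofReal_mul (by positivity), ENNReal.ofReal_mul (by positivity), mul_assoc]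
      gcongr
    have hmom : ∫⁻ x, (1 + V x) ∂(μ k) ≤ S := by
      rw [hSdef]
      exact le_iSup (fun n : ℕ => ∫⁻ x, (1 + V x) ∂(μ (n : ℤ))) k
    have hfin : ‖∫ x, g x * (∫ y, g y ∂(stepKernel K k m x) - ∫ y, g y ∂(μ (k + m))) ∂(μ k)‖ₑ
        ≤ ENNReal.ofReal (Mg ^ 2 * (Mt * α ^ m)) * S := by
      refine (enorm_integral_le_lintegral_enorm _).trans ((lintegral_mono hbound).trans ?_)
      rw [lintegral_const_mul _ (hV.const_add 1)]
      gcongr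
    have hreal := ENNReal.toReal_mono (ENNReal.mul_ne_top ENNReal.ofReal_ne_top hS.ne) hfin
    rw [toReal_enorm, ENNReal.toReal_mul, ENNReal.toReal_ofReal (by positivity),
      Real.norm_eq_abs] at hreal
    rw [hcov]
    refine (le_abs_self _).trans (hreal.trans_eq ?_)
    ring
  have hvar := variance_eq_sub (memLp_finsetSum' (Finset.range n) fun k _ => hL k)
  rw [variance_sum' fun k _ => hL k] at hvar
  simp only [Pi.pow_apply, Finset.sum_apply] at hvar
  rw [← hvar]
  refine (sum_sum_le_of_geometric
    (c := fun k l => cov[fun ω => g (X k ω), fun ω => g (X l ω); Pr])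
    (fun k l => covariance_comm _ _) hα0.le hα1 hC0 hdiag hoff n).trans ?_
  have : 0 ≤ (n : ℝ) * Mg ^ 2 := by positivity
  linear_combination this

end
end

section
/- Let μ₁, μ₂, ν be probability measures on a measurable space and let β∈(0,1). If μ₁(A) ≥ βν(A) and μ₂(A) ≥ βν(A) for every measurable set A, then ‖μ₁ − μ₂‖_TV ≤ 2(1−β). In particular, Doeblin-type minorization of a family of transition kernels implies the Contraction Condition bound with δ = β. -/
open MeasureTheory
open scoped ENNReal

noncomputable section

/-- If two probability measures both dominate `β ν` for a probability measure `ν`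
and `β ∈ (0,1)`, then their total variation distance is at most `2(1−β)`.
(Doeblin-type minorization implies the Contraction Condition bound with `δ = β`.) -/
theorem tvDist_le_of_minorization
    {S : Type*} [MeasurableSpace S] (μ₁ μ₂ ν : Measure S)
    [IsProbabilityMeasure μ₁] [IsProbabilityMeasure μ₂] [IsProbabilityMeasure ν]
    (β : ℝ) (hβ0 : 0 < β) (hβ1 : β < 1)
    (h₁ : ∀ A : Set S, MeasurableSet A → ENNReal.ofReal β * ν A ≤ μ₁ A)
    (h₂ : ∀ A : Set S, MeasurableSet A → ENNReal.ofReal β * ν A ≤ μ₂ A) :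
    tvDist μ₁ μ₂ ≤ 2 * (1 - β) := by
  have real_le {μ : Measure S} [IsProbabilityMeasure μ]
      (h : ∀ A : Set S, MeasurableSet A → ENNReal.ofReal β * ν A ≤ μ A)
      {A : Set S} (hA : MeasurableSet A) : β * ν.real A ≤ μ.real A := by
    simpa [Measure.real, ENNReal.toReal_mul, ENNReal.toReal_ofReal hβ0.le] using
      ENNReal.toReal_mono (measure_ne_top μ A) (h A hA)
  have : Nonempty {s : Set S // MeasurableSet s} := ⟨⟨∅, .empty⟩⟩
  refine mul_le_mul_of_nonneg_left (ciSup_le ?_) zero_le_two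
  rintro ⟨A, hA⟩
  change μ₁.real A - μ₂.real A ≤ 1 - β
  have hc := real_le h₁ hA.compl
  rw [probReal_compl_eq_one_sub hA, probReal_compl_eq_one_sub hA] at hc
  linarith [real_le h₂ hA]

end
end

section
/- On the three-point space 𝒳 = {1,2,3}, define the probability measures P(1,·) = (δ₁+δ₂)/2, P(2,·) = (δ₂+δ₃)/2, P(3,·) = (δ₃+δ₁)/2. Then: (i) ‖P(x,·) − P(y,·)‖_TV = 1 for all x ≠ y (so the contraction bound 2(1−δ) holds with δ = 1/2); and (ii) there exist no β > 0 and probability measure ν on 𝒳 such that P(x,A) ≥ βν(A) for all x∈𝒳 and all A ⊆ 𝒳. Hence the Contraction Condition does not imply Doeblin's Condition. -/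
open MeasureTheory
open scoped ENNReal

noncomputable section

/-- The transition law on the three-point space `{1,2,3}` (realized as `Fin 3`):
`P(x, ·) = (δ_x + δ_{x+1})/2` with cyclic addition, i.e.
`P(1,·) = (δ₁+δ₂)/2`, `P(2,·) = (δ₂+δ₃)/2`, `P(3,·) = (δ₃+δ₁)/2`. -/
def Pex : Fin 3 → Measure (Fin 3) :=
  fun x => (2 : ℝ≥0∞)⁻¹ • (Measure.dirac x + Measure.dirac (x + 1))

/-- The mass that `Pex x` gives to a set, as a real number. -/
theorem Pex_toReal (x : Fin 3) (A : Set (Fin 3)) :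
    (Pex x A).toReal = (A.indicator 1 x + A.indicator 1 (x + 1)) / 2 := by
  classical
  simp only [Pex, Measure.smul_apply, Measure.add_apply, Measure.dirac_apply, smul_eq_mul,
    Set.indicator_apply, Pi.one_apply]
  split_ifs <;> norm_num

theorem tvDist_Pex {x y : Fin 3} (hxy : x ≠ y) : tvDist (Pex x) (Pex y) = 1 := by
  classical
  have hle : ∀ A : {s : Set (Fin 3) // MeasurableSet s},
      (Pex x A.1).toReal - (Pex y A.1).toReal ≤ 1 / 2 := by
    rintro ⟨A, -⟩
    simp only [Pex_toReal, Set.indicator_apply, Pi.one_apply]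
    fin_cases x <;> fin_cases y <;> simp at hxy ⊢ <;> split_ifs <;> norm_num
  have hge : (Pex x {y + 2}).toReal - (Pex y {y + 2}).toReal = 1 / 2 := by
    simp only [Pex_toReal, Set.indicator_apply, Pi.one_apply, Set.mem_singleton_iff]
    fin_cases x <;> fin_cases y <;> simp at hxy ⊢
  have hsup : ⨆ A : {s : Set (Fin 3) // MeasurableSet s},
      ((Pex x A.1).toReal - (Pex y A.1).toReal) = 1 / 2 := by
    have : Nonempty {s : Set (Fin 3) // MeasurableSet s} := ⟨⟨∅, .empty⟩⟩
    exact le_antisymm (ciSup_le hle) (hge.symm.le.trans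
      (le_ciSup (f := fun A : {s : Set (Fin 3) // MeasurableSet s} =>
        (Pex x A.1).toReal - (Pex y A.1).toReal)
        ⟨1 / 2, Set.forall_mem_range.2 hle⟩ ⟨{y + 2}, .singleton _⟩))
  rw [tvDist, hsup]
  norm_num

theorem Pex_singleton_add_two (x : Fin 3) : Pex x {x + 2} = 0 := by
  simp [Pex]

/-- On the three point space, the kernel `Pex` satisfies the contraction bound
`‖P(x,·) − P(y,·)‖_TV = 1 = 2(1 − 1/2)` for `x ≠ y`, yet admits no Doeblin
minorization: the Contraction Condition does not imply Doeblin's Condition. -/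
theorem contraction_does_not_imply_doeblin :
    (∀ x y : Fin 3, x ≠ y → tvDist (Pex x) (Pex y) = 1) ∧
    ¬ ∃ (β : ℝ) (ν : Measure (Fin 3)), 0 < β ∧ IsProbabilityMeasure ν ∧
        ∀ (x : Fin 3) (A : Set (Fin 3)), ENNReal.ofReal β * ν A ≤ Pex x A := by
  refine ⟨fun x y => tvDist_Pex, ?_⟩
  rintro ⟨β, ν, hβ, hν, h⟩
  have hz : ∀ i : Fin 3, ν {i} = 0 := by
    intro i
    have hi := h (i + 1) {i + 1 + 2}
    rw [Pex_singleton_add_two, add_assoc, show (1 + 2 : Fin 3) = 0 from rfl, add_zero,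
      nonpos_iff_eq_zero, mul_eq_zero, ENNReal.ofReal_eq_zero] at hi
    exact hi.resolve_left hβ.not_ge
  exact IsProbabilityMeasure.ne_zero ν (Measure.ext_of_singleton fun i => by simp [hz i])

end
end

section
/- Let (X_n) be a time-inhomogeneous Markov chain on a Polish space 𝒳 with one-step kernels (K_n)_{n∈ℤ} satisfying the Drift Condition with function V and constants γ∈(0,1), C>0, and set C' := C/(1−γ). Fix R > C'/(1−γ) and set ρ := γ + C'/R, so ρ < 1, and C(R) := {x : V(x) ≤ R}. For a starting time s∈ℤ and starting state x (i.e., X_s = x), let τ := inf{ k ≥ 0 : X_{s+k} ∈ C(R) }. Then for every n ≥ 0, ℙ_{s,x}(τ > n) ≤ (V(x)/R)·ρⁿ. In particular, if V(x) < ∞ then ℙ_{s,x}(τ = ∞) = 0. -/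
open MeasureTheory ProbabilityTheory Filter
open scoped ENNReal NNReal

noncomputable section

/-- `X` is a time-inhomogeneous Markov chain started at time `s`, where `X n`
stands for the state at absolute time `s + n`:
`Pr(X_{n+1} ∈ A ∣ X_0,…,X_n) = K_{s+n+1}(X_n, A)` a.s. -/
def IsInhomMarkovFrom {Ω S : Type*} [MeasurableSpace Ω] [MeasurableSpace S]
    (Pr : Measure Ω) (s : ℤ) (X : ℕ → Ω → S) (K : ℤ → S → Measure S) : Prop :=
  (∀ n, Measurable (X n)) ∧
  ∀ (n : ℕ) (A : Set S), MeasurableSet A → ∀ B : Set Ω, MeasurableSet[pastSA X n] B →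
    Pr (B ∩ X (n + 1) ⁻¹' A) = ∫⁻ ω in B, K (s + n + 1) (X n ω) A ∂Pr

namespace IsInhomMarkovFrom

variable {Ω S : Type*} [MeasurableSpace Ω] [MeasurableSpace S]

/-- The Markov property tested against a nonnegative measurable function. -/
theorem setLIntegral_succ {Pr : Measure Ω} {s : ℤ} {X : ℕ → Ω → S} {K : ℤ → Kernel S S}
    (hX : IsInhomMarkovFrom Pr s X (fun k => ⇑(K k))) {f : S → ℝ≥0∞} (hf : Measurable f)
    (n : ℕ) {B : Set Ω} (hB : MeasurableSet[pastSA X n] B) :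
    ∫⁻ ω in B, f (X (n + 1) ω) ∂Pr
      = ∫⁻ ω in B, ∫⁻ y, f y ∂(K (s + n + 1) (X n ω)) ∂Pr := by
  have hmap : (Pr.restrict B).map (X (n + 1))
      = ((Pr.restrict B).map (X n)).bind (K (s + n + 1)) := by
    ext A hA
    rw [Measure.map_apply (hX.1 _) hA, Measure.restrict_apply (hX.1 _ hA),
      Measure.bind_apply hA (K _).aemeasurable,
      lintegral_map ((K _).measurable_coe hA) (hX.1 n), Set.inter_comm]
    exact hX.2 n A hA B hB
  rw [← lintegral_map hf (hX.1 (n + 1)), hmap,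
    Measure.lintegral_bind (K _).aemeasurable hf.aemeasurable,
    lintegral_map hf.lintegral_kernel (hX.1 n)]

end IsInhomMarkovFrom

theorem measurableSet_pastSA_forall_lt {Ω S : Type*} [MeasurableSpace S] (X : ℕ → Ω → S)
    {V : S → ℝ≥0∞} (hV : Measurable V) (R : ℝ≥0∞) (n : ℕ) :
    MeasurableSet[pastSA X n] {ω | ∀ k ≤ n, R < V (X k ω)} := by
  simp only [Set.ofPred_forall]
  refine MeasurableSet.iInter fun k => MeasurableSet.iInter fun hk => ?_
  exact le_iSup (fun i : Fin (n + 1) => MeasurableSpace.comap (X i) inferInstance)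
    ⟨k, Nat.lt_succ_of_le hk⟩ _ ⟨V ⁻¹' Set.Ioi R, hV measurableSet_Ioi, rfl⟩

/-- Under a drift condition, the expectation of `V` on the event of not yet having entered
`{V ≤ R}` contracts by the factor `γ + C / R` at each step. -/
theorem IsInhomMarkovFrom.setLIntegral_forall_lt_le {Ω S : Type*} [MeasurableSpace Ω]
    [MeasurableSpace S] {Pr : Measure Ω} {s : ℤ} {X : ℕ → Ω → S} {K : ℤ → Kernel S S}
    (hX : IsInhomMarkovFrom Pr s X (fun k => ⇑(K k))) {V : S → ℝ≥0∞} (hV : Measurable V)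
    {γ C R : ℝ≥0∞} (hdrift : ∀ (n : ℤ) (x : S), ∫⁻ y, V y ∂(K n x) ≤ γ * V x + C)
    (hR0 : R ≠ 0) (hRtop : R ≠ ⊤) (n : ℕ) :
    ∫⁻ ω in {ω | ∀ k ≤ n, R < V (X k ω)}, V (X n ω) ∂Pr
      ≤ (γ + C / R) ^ n * ∫⁻ ω, V (X 0 ω) ∂Pr := by
  induction n with
  | zero => simpa using setLIntegral_le_lintegral _ _
  | succ n ih =>
    have hpast := measurableSet_pastSA_forall_lt X hV R n
    have hB : MeasurableSet {ω | ∀ k ≤ n, R < V (X k ω)} :=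
      iSup_le (fun i : Fin (n + 1) => (hX.1 i).comap_le) _ hpast
    calc ∫⁻ ω in {ω | ∀ k ≤ n + 1, R < V (X k ω)}, V (X (n + 1) ω) ∂Pr
        ≤ ∫⁻ ω in {ω | ∀ k ≤ n, R < V (X k ω)}, V (X (n + 1) ω) ∂Pr :=
          lintegral_mono_set fun ω hω k hk => hω k (hk.trans n.le_succ)
      _ = ∫⁻ ω in {ω | ∀ k ≤ n, R < V (X k ω)},
            ∫⁻ y, V y ∂(K (s + n + 1) (X n ω)) ∂Pr := hX.setLIntegral_succ hV n hpast
      _ ≤ ∫⁻ ω in {ω | ∀ k ≤ n, R < V (X k ω)}, (γ + C / R) * V (X n ω) ∂Pr := by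
          refine setLIntegral_mono' hB fun ω hω => (hdrift _ _).trans ?_
          rw [add_mul]
          gcongr
          calc C = C / R * R := (ENNReal.div_mul_cancel hR0 hRtop).symm
            _ ≤ C / R * V (X n ω) := by gcongr; exact (hω n le_rfl).le
      _ = (γ + C / R) * ∫⁻ ω in {ω | ∀ k ≤ n, R < V (X k ω)}, V (X n ω) ∂Pr :=
          lintegral_const_mul _ (hV.comp (hX.1 n))
      _ ≤ (γ + C / R) ^ (n + 1) * ∫⁻ ω, V (X 0 ω) ∂Pr := by
          rw [pow_succ', mul_assoc]
          gcongr

/-- **Geometric tail for the return time to a sublevel set of `V`.**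
Under the Drift Condition, with `C' = C/(1−γ)`, `R > C'/(1−γ)`, `ρ = γ + C'/R < 1`,
and `τ = inf {k ≥ 0 : V(X_{s+k}) ≤ R}`, one has `ℙ_{s,x}(τ > n) ≤ (V(x)/R)·ρⁿ`;
in particular `ℙ_{s,x}(τ = ∞) = 0` when `V(x) < ∞`. -/
theorem return_time_geometric_tail
    {𝒳 : Type*} [MeasurableSpace 𝒳] [TopologicalSpace 𝒳] [PolishSpace 𝒳] [BorelSpace 𝒳]
    {Ω : Type*} [MeasurableSpace Ω] (Pr : Measure Ω) [IsProbabilityMeasure Pr]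
    -- the one-step Markov kernels
    (K : ℤ → Kernel 𝒳 𝒳) (hK : ∀ n, IsMarkovKernel (K n))
    -- Drift Condition
    (V : 𝒳 → ℝ≥0∞) (hV : Measurable V) (hVne : ∃ x, V x < ⊤)
    (γ C : ℝ≥0∞) (hγ0 : 0 < γ) (hγ1 : γ < 1) (hC0 : 0 < C) (hCtop : C < ⊤)
    (hdrift : ∀ (n : ℤ) (x : 𝒳), ∫⁻ y, V y ∂(K n x) ≤ γ * V x + C)
    -- the level `R`, with `C' := C/(1−γ)` and `R > C'/(1−γ)`
    (R : ℝ≥0∞) (hR : C / (1 - γ) / (1 - γ) < R)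
    -- the chain, started at time `s` from the state `x`
    (s : ℤ) (x : 𝒳) (X : ℕ → Ω → 𝒳)
    (hX : IsInhomMarkovFrom Pr s X (fun k => ⇑(K k)))
    (hX0 : ∀ᵐ ω ∂Pr, X 0 ω = x) :
    (∀ n : ℕ, Pr {ω | ∀ k ≤ n, R < V (X k ω)}
        ≤ V x / R * (γ + (C / (1 - γ)) / R) ^ n) ∧
    (V x < ⊤ → Pr {ω | ∀ k : ℕ, R < V (X k ω)} = 0) := by
  have h_ne : 1 - γ ≠ 0 := (tsub_pos_of_lt hγ1).ne'
  have h_ne_top : 1 - γ ≠ ⊤ := (tsub_le_self.trans_lt ENNReal.one_lt_top).ne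
  have hR0 : R ≠ 0 := (bot_le.trans_lt hR).ne'
  have tail : ∀ n : ℕ, Pr {ω | ∀ k ≤ n, R < V (X k ω)}
      ≤ V x / R * (γ + (C / (1 - γ)) / R) ^ n := by
    intro n
    rcases eq_or_ne R ⊤ with rfl | hRtop
    · have : {ω | ∀ k ≤ n, ⊤ < V (X k ω)} = ∅ :=
        Set.eq_empty_of_forall_notMem fun ω hω => not_top_lt (hω 0 n.zero_le)
      rw [this, measure_empty]
      exact bot_le
    have hCC : C ≤ C / (1 - γ) := by
      rw [ENNReal.le_div_iff_mul_le (.inl h_ne) (.inl h_ne_top)]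
      exact mul_le_of_le_one_right' tsub_le_self
    have hB : MeasurableSet {ω | ∀ k ≤ n, R < V (X k ω)} :=
      iSup_le (fun i : Fin (n + 1) => (hX.1 i).comap_le) _
        (measurableSet_pastSA_forall_lt X hV R n)
    have h_start : ∫⁻ ω, V (X 0 ω) ∂Pr = V x := by
      rw [lintegral_congr_ae (hX0.mono fun ω hω => congrArg V hω)]
      simp
    rw [← ENNReal.mul_div_right_comm, ENNReal.le_div_iff_mul_le (.inl hR0) (.inl hRtop)]
    calc Pr {ω | ∀ k ≤ n, R < V (X k ω)} * R
        = ∫⁻ _ in {ω | ∀ k ≤ n, R < V (X k ω)}, R ∂Pr := by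
          rw [setLIntegral_const, mul_comm]
      _ ≤ ∫⁻ ω in {ω | ∀ k ≤ n, R < V (X k ω)}, V (X n ω) ∂Pr :=
          setLIntegral_mono' hB fun ω hω => (hω n le_rfl).le
      _ ≤ (γ + C / R) ^ n * V x :=
          h_start ▸ hX.setLIntegral_forall_lt_le hV hdrift hR0 hRtop n
      _ ≤ V x * (γ + (C / (1 - γ)) / R) ^ n := by
          rw [mul_comm]
          gcongr
  refine ⟨tail, fun hVx => ?_⟩
  have hρ : γ + (C / (1 - γ)) / R < 1 := by
    have h_div : (C / (1 - γ)) / R < 1 - γ := by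
      refine ENNReal.div_lt_of_lt_mul' ?_
      rwa [ENNReal.div_lt_iff (.inl h_ne) (.inl h_ne_top)] at hR
    calc γ + (C / (1 - γ)) / R < γ + (1 - γ) :=
          ENNReal.add_lt_add_left hγ1.ne_top h_div
      _ = 1 := add_tsub_cancel_of_le hγ1.le
  have h_lim : Tendsto (fun n : ℕ => V x / R * (γ + (C / (1 - γ)) / R) ^ n) atTop (nhds 0) := by
    simpa using ENNReal.Tendsto.const_mul (ENNReal.tendsto_pow_atTop_nhds_zero_of_lt_one hρ)
      (.inr (ENNReal.div_lt_top hVx.ne hR0).ne)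
  exact le_antisymm (ge_of_tendsto' h_lim fun n =>
    (measure_mono (Set.ofPred_subset_ofPred.2 fun ω hω k _ => hω k)).trans (tail n)) bot_le

end
end

section
/- Let (K_n)_{n∈ℤ} be one-step Markov kernels on a Polish space 𝒳 satisfying the Drift Condition with function V and constants γ∈(0,1), C>0. Fix R > C/(1−γ)², β∈(0,1) and a probability measure ν with K_n(x,·) ≥ βν(·) for all n∈ℤ and x∈C(R):={V≤R}. Let (X_n, δ_n)_{n≥s} be a split chain started at time s from (x,i) with V(x) < ∞, i.e., a process on 𝒳×{0,1} satisfying: ℙ(δ_n = 1 | X_s,…,X_n, δ_s,…,δ_{n−1}) = β·1_{C(R)}(X_n) a.s.; on {δ_n = 1} the conditional law of X_{n+1} given 𝓕_n := σ(X_s,…,X_n,δ_s,…,δ_n) is ν; on {δ_n = 0}, the conditional law of X_{n+1} given 𝓕_n is (K_{n+1}(X_n,·) − βν)/(1−β) if X_n∈C(R), and K_{n+1}(X_n,·) if X_n∉C(R). Let τ̌ := inf{ k ≥ 0 : δ_{s+k} = 1 }. Then there exist constants K > 0 and ζ ∈ (0,1) such that ℙ(τ̌ > n) ≤ K·ζⁿ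 for all n ≥ 0; in particular ℙ(τ̌ = ∞) = 0. -/
open MeasureTheory ProbabilityTheory Filter
open scoped ENNReal

noncomputable section

/-- `𝓖_n = σ(X_0,…,X_n, δ_0,…,δ_{n−1})` for the split chain (times relative to the
starting time). -/
def splitG {Ω 𝒳 : Type*} [MeasurableSpace 𝒳] (X : ℕ → Ω → 𝒳) (δ : ℕ → Ω → Bool)
    (n : ℕ) : MeasurableSpace Ω :=
  (⨆ i : Fin (n + 1), MeasurableSpace.comap (X i) inferInstance) ⊔
    (⨆ i : Fin n, MeasurableSpace.comap (δ i) inferInstance)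

/-- `𝓕_n = σ(X_0,…,X_n, δ_0,…,δ_n)` for the split chain. -/
def splitF {Ω 𝒳 : Type*} [MeasurableSpace 𝒳] (X : ℕ → Ω → 𝒳) (δ : ℕ → Ω → Bool)
    (n : ℕ) : MeasurableSpace Ω :=
  splitG X δ n ⊔ MeasurableSpace.comap (δ n) inferInstance

/-- The choice of weight and rate that turns `1 + ε V` into a contracted function for the chain
killed at rate `β` on `{V ≤ R}`. -/
lemma exists_contraction_weight_real {g c r β : ℝ} (hg0 : 0 < g) (hg1 : g < 1) (hc : 0 < c)
    (hr : c ≤ (1 - g) * (1 - g) * r) (hβ0 : 0 < β) (hβ1 : β < 1) :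
    ∃ ε ζ : ℝ, 0 < ε ∧ 0 < ζ ∧ ζ < 1 ∧
      (∀ v, 0 ≤ v → v ≤ r → 1 - β + ε * (g * v + c) ≤ ζ * (1 + ε * v)) ∧
      (∀ v, r ≤ v → 1 + ε * (g * v + c) ≤ ζ * (1 + ε * v)) := by
  have hg2 : 0 < 1 - g := by linarith
  have hr0 : 0 < r := by
    by_contra! h
    nlinarith [mul_pos hg2 hg2]
  have hd : 0 < g * r + c := by positivity
  obtain ⟨ε, hε0, hε⟩ : ∃ ε : ℝ, 0 < ε ∧ ε * (g * r + c) = β / 2 :=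
    ⟨β / 2 / (g * r + c), by positivity, by field_simp⟩
  have her : 0 < ε * r := by positivity
  obtain ⟨η, hη0, hηβ, hη⟩ : ∃ η : ℝ, 0 < η ∧ η ≤ β / 2 ∧
      η * (1 + ε * r) ≤ ε * r * (g * (1 - g)) := by
    refine ⟨min (β / 2) (ε * r * (g * (1 - g)) / (1 + ε * r)), by positivity,
      min_le_left _ _, ?_⟩
    rw [← le_div_iff₀ (by positivity)]
    exact min_le_right _ _
  have hηg : η ≤ g * (1 - g) := by
    by_contra! h
    nlinarith [mul_pos her (sub_pos.2 h)]
  refine ⟨ε, 1 - η, hε0, by linarith, by linarith, fun v hv0 hv => ?_, fun v hv => ?_⟩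
  · have h1 : ε * (g * v + c) ≤ ε * (g * r + c) := by gcongr
    have h2 : 0 ≤ (1 - η) * (ε * v) := mul_nonneg (by linarith) (by positivity)
    linarith
  · have h1 : ε * c ≤ ε * ((1 - g) * (1 - g) * v) := by
      gcongr
      exact hr.trans (by gcongr)
    have h2 : 0 ≤ (g * (1 - g) - η) * (ε * (v - r)) :=
      mul_nonneg (by linarith) (mul_nonneg hε0.le (by linarith))
    nlinarith

lemma exists_contraction_weight {γ C R : ℝ≥0∞} (hγ0 : 0 < γ) (hγ1 : γ < 1) (hC0 : 0 < C)
    (hCtop : C < ⊤) (hR : C / ((1 - γ) * (1 - γ)) < R) {β : ℝ} (hβ0 : 0 < β) (hβ1 : β < 1) :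
    ∃ ε ζ : ℝ, 0 ≤ ε ∧ 0 < ζ ∧ ζ < 1 ∧
      (∀ v : ℝ≥0∞, v ≤ R → ENNReal.ofReal (1 - β) + ENNReal.ofReal ε * (γ * v + C) ≤
        ENNReal.ofReal ζ * (1 + ENNReal.ofReal ε * v)) ∧
      (∀ v : ℝ≥0∞, R < v → 1 + ENNReal.ofReal ε * (γ * v + C) ≤
        ENNReal.ofReal ζ * (1 + ENNReal.ofReal ε * v)) := by
  rcases eq_or_ne R ⊤ with rfl | hRtop
  · exact ⟨0, 1 - β, le_rfl, by linarith, by linarith, by simp, by simp⟩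
  obtain ⟨g, hg0, rfl⟩ : ∃ g : ℝ, 0 ≤ g ∧ γ = ENNReal.ofReal g :=
    ⟨γ.toReal, ENNReal.toReal_nonneg, (ENNReal.ofReal_toReal hγ1.ne_top).symm⟩
  obtain ⟨c, hc0, rfl⟩ : ∃ c : ℝ, 0 ≤ c ∧ C = ENNReal.ofReal c :=
    ⟨C.toReal, ENNReal.toReal_nonneg, (ENNReal.ofReal_toReal hCtop.ne).symm⟩
  obtain ⟨r, hr0, rfl⟩ : ∃ r : ℝ, 0 ≤ r ∧ R = ENNReal.ofReal r :=
    ⟨R.toReal, ENNReal.toReal_nonneg, (ENNReal.ofReal_toReal hRtop).symm⟩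
  rw [ENNReal.ofReal_pos] at hγ0 hC0
  rw [ENNReal.ofReal_lt_one] at hγ1
  have hg2 : 0 < 1 - g := by linarith
  have hcr : c ≤ (1 - g) * (1 - g) * r := by
    rw [← ENNReal.ofReal_one, ← ENNReal.ofReal_sub _ hg0, ← ENNReal.ofReal_mul hg2.le,
      ← ENNReal.ofReal_div_of_pos (by positivity)] at hR
    have := (ENNReal.ofReal_lt_ofReal_iff'.1 hR).1
    rw [div_lt_iff₀ (by positivity)] at this
    linarith
  obtain ⟨ε, ζ, hε, hζ0, hζ1, h1, h2⟩ := exists_contraction_weight_real hγ0 hγ1 hC0 hcr hβ0 hβ1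
  have hleft (a v : ℝ) (ha : 0 ≤ a) (hv : 0 ≤ v) :
      ENNReal.ofReal a + ENNReal.ofReal ε *
        (ENNReal.ofReal g * ENNReal.ofReal v + ENNReal.ofReal c) =
      ENNReal.ofReal (a + ε * (g * v + c)) := by
    rw [ENNReal.ofReal_add ha (by positivity), ENNReal.ofReal_mul hε.le,
      ENNReal.ofReal_add (by positivity) hc0, ENNReal.ofReal_mul hg0]
  have hright (v : ℝ) (hv : 0 ≤ v) :
      ENNReal.ofReal ζ * (1 + ENNReal.ofReal ε * ENNReal.ofReal v) =
        ENNReal.ofReal (ζ * (1 + ε * v)) := by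
    rw [ENNReal.ofReal_mul hζ0.le, ENNReal.ofReal_add zero_le_one (by positivity),
      ENNReal.ofReal_mul hε.le, ENNReal.ofReal_one]
  refine ⟨ε, ζ, hε.le, hζ0, hζ1, fun v hv => ?_, fun v hv => ?_⟩
  · obtain ⟨w, hw0, rfl⟩ : ∃ w : ℝ, 0 ≤ w ∧ v = ENNReal.ofReal w :=
      ⟨v.toReal, ENNReal.toReal_nonneg,
        (ENNReal.ofReal_toReal (hv.trans_lt ENNReal.ofReal_lt_top).ne).symm⟩
    rw [hleft _ _ (by linarith) hw0, hright _ hw0]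
    exact ENNReal.ofReal_le_ofReal (h1 w hw0 ((ENNReal.ofReal_le_ofReal_iff hr0).1 hv))
  · rcases eq_or_ne v ⊤ with rfl | hvtop
    · simp [ENNReal.mul_top, hε, hζ0]
    obtain ⟨w, hw0, rfl⟩ : ∃ w : ℝ, 0 ≤ w ∧ v = ENNReal.ofReal w :=
      ⟨v.toReal, ENNReal.toReal_nonneg, (ENNReal.ofReal_toReal hvtop).symm⟩
    rw [← ENNReal.ofReal_one, hleft _ _ zero_le_one hw0, ENNReal.ofReal_one, hright _ hw0]
    exact ENNReal.ofReal_le_ofReal (h2 w ((ENNReal.ofReal_le_ofReal_iff hw0).1 hv.le))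

lemma measurable_splitG_state {Ω 𝒳 : Type*} [MeasurableSpace 𝒳] (X : ℕ → Ω → 𝒳)
    (δ : ℕ → Ω → Bool) (n : ℕ) : Measurable[splitG X δ n] (X n) :=
  Measurable.mono (comap_measurable (X n))
    (le_sup_of_le_left (le_iSup (fun i : Fin (n + 1) =>
      MeasurableSpace.comap (X i) inferInstance) (Fin.last n))) le_rfl

/-- The event that no coin tossed strictly before time `n` succeeds. -/
def noSuccessBefore {Ω : Type*} (δ : ℕ → Ω → Bool) (n : ℕ) : Set Ω :=
  {ω | ∀ k < n, δ k ω = false}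

lemma noSuccessBefore_succ {Ω : Type*} (δ : ℕ → Ω → Bool) (n : ℕ) :
    noSuccessBefore δ (n + 1) = noSuccessBefore δ n ∩ {ω | δ n ω = false} := by
  ext ω
  simp [noSuccessBefore, le_iff_lt_or_eq, or_imp, forall_and]

lemma measurableSet_noSuccessBefore {Ω 𝒳 : Type*} [MeasurableSpace 𝒳] (X : ℕ → Ω → 𝒳)
    (δ : ℕ → Ω → Bool) (n : ℕ) : MeasurableSet[splitG X δ n] (noSuccessBefore δ n) := by
  have h : noSuccessBefore δ n = ⋂ k : Fin n, δ k ⁻¹' {false} := by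
    ext ω
    simp [noSuccessBefore, Fin.forall_iff]
  rw [h]
  refine MeasurableSet.iInter fun k => ?_
  have hle : MeasurableSpace.comap (δ k) inferInstance ≤ splitG X δ n :=
    le_sup_of_le_right (le_iSup (fun i : Fin n =>
      MeasurableSpace.comap (δ i) inferInstance) k)
  exact hle _ ⟨{false}, measurableSet_singleton _, rfl⟩

/-- If on an event the law of `Y` is dominated by the mixture of `κ (Z ω)` with density `g (Z ω)`,
the same domination holds for integrals of nonnegative functions. -/
lemma setLIntegral_comp_le_of_measure_le {Ω 𝒳 : Type*} [MeasurableSpace Ω] [MeasurableSpace 𝒳]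
    {μ : Measure Ω} {Y Z : Ω → 𝒳} (hY : Measurable Y) (hZ : Measurable Z) {D E : Set Ω}
    (κ : Kernel 𝒳 𝒳) {g : 𝒳 → ℝ≥0∞} (hg : Measurable g)
    (h : ∀ A, MeasurableSet A → μ (D ∩ Y ⁻¹' A) ≤ ∫⁻ ω in E, g (Z ω) * κ (Z ω) A ∂μ)
    {f : 𝒳 → ℝ≥0∞} (hf : Measurable f) :
    ∫⁻ ω in D, f (Y ω) ∂μ ≤ ∫⁻ ω in E, g (Z ω) * ∫⁻ y, f y ∂(κ (Z ω)) ∂μ := by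
  have hle : (μ.restrict D).map Y ≤
      (((μ.restrict E).map Z).withDensity g).bind κ := by
    refine Measure.le_iff.2 fun A hA => ?_
    rw [Measure.map_apply hY hA, Measure.restrict_apply (hY hA), Set.inter_comm,
      Measure.bind_apply hA κ.aemeasurable,
      lintegral_withDensity_eq_lintegral_mul _ hg (κ.measurable_coe hA),
      lintegral_map (hg.mul (κ.measurable_coe hA)) hZ]
    exact h A hA
  calc ∫⁻ ω in D, f (Y ω) ∂μ = ∫⁻ y, f y ∂((μ.restrict D).map Y) := (lintegral_map hf hY).symm
    _ ≤ ∫⁻ y, f y ∂((((μ.restrict E).map Z).withDensity g).bind κ) := lintegral_mono' hle le_rfl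
    _ = _ := by
      rw [Measure.lintegral_bind κ.aemeasurable hf.aemeasurable,
        lintegral_withDensity_eq_lintegral_mul _ hg hf.lintegral_kernel,
        lintegral_map (hg.mul hf.lintegral_kernel) hZ]
      rfl

/-- If a coin succeeds on `B` with conditional probability `β 1_S(Z)`, it fails on `B` with
conditional probability `1 - β 1_S(Z)`. -/
lemma measure_inter_failure_eq {Ω 𝒳 : Type*} [MeasurableSpace Ω] [MeasurableSpace 𝒳]
    {μ : Measure Ω} [IsFiniteMeasure μ] {d : Ω → Bool} (hd : Measurable d) {Z : Ω → 𝒳}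
    {p : 𝒳 → Prop} [DecidablePred p] (hZ : Measurable Z) (hp : MeasurableSet {y | p y})
    {β : ℝ} (hβ0 : 0 ≤ β) (hβ1 : β ≤ 1) {B : Set Ω}
    (h : μ (B ∩ {ω | d ω = true}) =
      ∫⁻ ω in B, (if p (Z ω) then ENNReal.ofReal β else 0) ∂μ) :
    μ (B ∩ {ω | d ω = false}) =
      ∫⁻ ω in B, (if p (Z ω) then ENNReal.ofReal (1 - β) else 1) ∂μ := by
  have hmeas : Measurable fun ω => if p (Z ω) then ENNReal.ofReal β else 0 :=
    Measurable.ite (hZ hp) measurable_const measurable_const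
  have hsum : μ (B ∩ {ω | d ω = true}) + μ (B ∩ {ω | d ω = false}) =
      μ (B ∩ {ω | d ω = true}) +
        ∫⁻ ω in B, (if p (Z ω) then ENNReal.ofReal (1 - β) else 1) ∂μ := by
    have hcompl : B ∩ {ω | d ω = false} = B \ {ω | d ω = true} := by
      ext ω
      simp
    rw [hcompl, measure_inter_add_sdiff B (show MeasurableSet {ω | d ω = true} from
      hd (measurableSet_singleton true)), h,
      ← lintegral_add_left hmeas, ← setLIntegral_one]
    refine lintegral_congr fun ω => ?_
    split_ifs
    · rw [← ENNReal.ofReal_add hβ0 (by linarith)]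
      simp
    · simp
  exact (ENNReal.add_right_inj (measure_ne_top _ _)).1 hsum

/-- **Geometric tail for the regeneration time of the Nummelin split chain.**
Under the Drift Condition and the Doeblin minorization on `C(R) = {V ≤ R}` with
`R > C/(1−γ)²`, the first time `τ̌ = inf{k ≥ 0 : δ_{s+k} = 1}` at which the split
chain regenerates has a geometric tail: `ℙ(τ̌ > n) ≤ K·ζⁿ`; in particular
`ℙ(τ̌ = ∞) = 0`. -/
theorem split_chain_regeneration_geometric_tail
    {𝒳 : Type*} [MeasurableSpace 𝒳] [TopologicalSpace 𝒳] [PolishSpace 𝒳] [BorelSpace 𝒳]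
    {Ω : Type*} [MeasurableSpace Ω] (Pr : Measure Ω) [IsProbabilityMeasure Pr]
    -- the one-step Markov kernels
    (K : ℤ → Kernel 𝒳 𝒳) (hK : ∀ n, IsMarkovKernel (K n))
    -- Drift Condition
    (V : 𝒳 → ℝ≥0∞) (hV : Measurable V) (hVne : ∃ x, V x < ⊤)
    (γ C : ℝ≥0∞) (hγ0 : 0 < γ) (hγ1 : γ < 1) (hC0 : 0 < C) (hCtop : C < ⊤)
    (hdrift : ∀ (n : ℤ) (x : 𝒳), ∫⁻ y, V y ∂(K n x) ≤ γ * V x + C)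
    -- the level `R > C/(1−γ)²` and the Doeblin minorization on `C(R) = {V ≤ R}`
    (R : ℝ≥0∞) (hR : C / ((1 - γ) * (1 - γ)) < R)
    (β : ℝ) (hβ0 : 0 < β) (hβ1 : β < 1)
    (ν : Measure 𝒳) (hν : IsProbabilityMeasure ν)
    (hdoeb : ∀ (n : ℤ) (x : 𝒳), V x ≤ R → ∀ A : Set 𝒳, MeasurableSet A →
      ENNReal.ofReal β * ν A ≤ K n x A)
    -- the split chain `(X_n, δ_n)` started at time `s` from `(x, i)`, `V x < ∞`
    (s : ℤ) (x : 𝒳) (i : Bool) (hx : V x < ⊤)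
    (X : ℕ → Ω → 𝒳) (δ : ℕ → Ω → Bool)
    (hXmeas : ∀ n, Measurable (X n)) (hδmeas : ∀ n, Measurable (δ n))
    (hinit : ∀ᵐ ω ∂Pr, X 0 ω = x ∧ δ 0 ω = i)
    -- `ℙ(δ_n = 1 ∣ 𝓖_n) = β·1_{C(R)}(X_n)` a.s. (for times after the start)
    (hbell : ∀ n : ℕ, 1 ≤ n → ∀ B : Set Ω, MeasurableSet[splitG X δ n] B →
      Pr (B ∩ {ω | δ n ω = true})
        = ∫⁻ ω in B, (if V (X n ω) ≤ R then ENNReal.ofReal β else 0) ∂Pr)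
    -- on `{δ_n = 1}` the next state is drawn from `ν`
    (hregen : ∀ (n : ℕ) (B : Set Ω), MeasurableSet[splitF X δ n] B →
      ∀ A : Set 𝒳, MeasurableSet A →
        Pr ((B ∩ {ω | δ n ω = true}) ∩ X (n + 1) ⁻¹' A)
          = ν A * Pr (B ∩ {ω | δ n ω = true}))
    -- on `{δ_n = 0}` the next state is drawn from the residual kernel
    (hres : ∀ (n : ℕ) (B : Set Ω), MeasurableSet[splitF X δ n] B →
      ∀ A : Set 𝒳, MeasurableSet A →
        Pr ((B ∩ {ω | δ n ω = false}) ∩ X (n + 1) ⁻¹' A)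
          = ∫⁻ ω in B ∩ {ω | δ n ω = false},
              (if V (X n ω) ≤ R
                then (ENNReal.ofReal (1 - β))⁻¹
                  * (K (s + n + 1) (X n ω) A - ENNReal.ofReal β * ν A)
                else K (s + n + 1) (X n ω) A) ∂Pr) :
    ∃ (Kc ζ : ℝ), 0 < Kc ∧ 0 < ζ ∧ ζ < 1 ∧
      (∀ n : ℕ, Pr {ω | ∀ k ≤ n, δ k ω = false} ≤ ENNReal.ofReal (Kc * ζ ^ n)) ∧
      Pr {ω | ∀ k : ℕ, δ k ω = false} = 0 := by
  classical
  obtain ⟨ε, ζ, hε0, hζ0, hζ1, hin, hout⟩ :=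
    exists_contraction_weight hγ0 hγ1 hC0 hCtop hR hβ0 hβ1
  set e := ENNReal.ofReal ε
  set z := ENNReal.ofReal ζ
  set D := noSuccessBefore δ with hD
  have hCset : MeasurableSet {y | V y ≤ R} := measurableSet_le hV measurable_const
  let g : 𝒳 → ℝ≥0∞ := fun y => if V y ≤ R then (ENNReal.ofReal (1 - β))⁻¹ else 1
  let w : 𝒳 → ℝ≥0∞ := fun y => if V y ≤ R then ENNReal.ofReal (1 - β) else 1
  have hg : Measurable g := Measurable.ite hCset measurable_const measurable_const
  have hw : Measurable w := Measurable.ite hCset measurable_const measurable_const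
  have hwg (y : 𝒳) : w y * g y = 1 := by
    simp only [w, g]
    split_ifs
    · exact ENNReal.mul_inv_cancel (by simpa using hβ1) ENNReal.ofReal_ne_top
    · simp
  have hstep (n : ℕ) : ∫⁻ ω in D (n + 1), V (X (n + 1) ω) ∂Pr ≤
      ∫⁻ ω in D (n + 1), g (X n ω) * (γ * V (X n ω) + C) ∂Pr := by
    refine (setLIntegral_comp_le_of_measure_le (hXmeas (n + 1)) (hXmeas n) (K (s + n + 1)) hg
      (E := D (n + 1)) (fun A hA => ?_) hV).trans
      (lintegral_mono fun ω => mul_le_mul_right (hdrift _ _) _)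
    rw [hD, noSuccessBefore_succ, hres n _ (le_sup_left (a := splitG X δ n) _
      (measurableSet_noSuccessBefore X δ n)) A hA]
    refine lintegral_mono fun ω => ?_
    simp only [g]
    split_ifs
    · exact mul_le_mul_right tsub_le_self _
    · simp
  have hcoin (n : ℕ) (hn : 1 ≤ n) (f : 𝒳 → ℝ≥0∞) (hf : Measurable f) :
      ∫⁻ ω in D (n + 1), f (X n ω) ∂Pr ≤ ∫⁻ ω in D n, w (X n ω) * f (X n ω) ∂Pr := by
    have := setLIntegral_comp_le_of_measure_le (μ := Pr) (D := D (n + 1)) (E := D n) (hXmeas n)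
      (hXmeas n) Kernel.id hw (fun A hA => ?_) hf
    · simpa [Kernel.id_apply, lintegral_dirac' _ hf] using this
    have hBG : MeasurableSet[splitG X δ n] (D n ∩ X n ⁻¹' A) :=
      (measurableSet_noSuccessBefore X δ n).inter (measurable_splitG_state X δ n hA)
    rw [hD, noSuccessBefore_succ, Set.inter_right_comm,
      measure_inter_failure_eq (hδmeas n) (hXmeas n) hCset hβ0.le hβ1.le (hbell n hn _ hBG),
      Set.inter_comm, ← Measure.restrict_restrict (hXmeas n hA),
      ← lintegral_indicator (hXmeas n hA)]
    refine lintegral_mono fun ω => ?_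
    by_cases hω : X n ω ∈ A <;> simp [w, Kernel.id_apply, Measure.dirac_apply' _ hA, hω]
  let I : ℕ → ℝ≥0∞ := fun n => ∫⁻ ω in D n, (1 + e * V (X n ω)) ∂Pr
  have hIstep (n : ℕ) : I (n + 1) ≤
      ∫⁻ ω in D (n + 1), (1 + e * (g (X n ω) * (γ * V (X n ω) + C))) ∂Pr := by
    have hm : Measurable fun ω => g (X n ω) * (γ * V (X n ω) + C) :=
      (hg.comp (hXmeas n)).mul (((hV.comp (hXmeas n)).const_mul γ).add_const C)
    simp only [I]
    rw [lintegral_add_left measurable_const, lintegral_add_left measurable_const,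
      lintegral_const_mul _ (show Measurable fun ω => V (X (n + 1) ω) from
        hV.comp (hXmeas (n + 1))), lintegral_const_mul _ hm]
    exact add_le_add_right (mul_le_mul_right (hstep n) _) _
  have hI (n : ℕ) (hn : 1 ≤ n) : I (n + 1) ≤ z * I n := by
    refine (hIstep n).trans ((hcoin n hn (fun y => 1 + e * (g y * (γ * V y + C)))
      (by fun_prop)).trans ?_)
    simp only [I]
    rw [← lintegral_const_mul _ (by have := hXmeas n; fun_prop)]
    refine lintegral_mono fun ω => ?_
    have hsplit : w (X n ω) * (1 + e * (g (X n ω) * (γ * V (X n ω) + C))) =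
        w (X n ω) + e * (γ * V (X n ω) + C) := by
      calc _ = w (X n ω) + (w (X n ω) * g (X n ω)) * (e * (γ * V (X n ω) + C)) := by ring
        _ = _ := by rw [hwg, one_mul]
    rw [hsplit]
    simp only [w]
    split_ifs with h
    · exact hin _ h
    · exact hout _ (not_le.1 h)
  have hI1 : I 1 ≠ ⊤ := by
    refine ((hIstep 0).trans ((setLIntegral_le_lintegral _ _).trans_eq
      (lintegral_congr_ae (g := fun _ => 1 + e * (g x * (γ * V x + C))) ?_))).trans_lt ?_ |>.ne
    · filter_upwards [hinit] with ω hω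
      rw [hω.1]
    · have hgx : g x < ⊤ := by
        simp only [g]
        split_ifs
        · simpa using hβ1
        · simp
      simp only [lintegral_const, measure_univ, mul_one]
      exact ENNReal.add_lt_top.2 ⟨ENNReal.one_lt_top, ENNReal.mul_lt_top ENNReal.ofReal_lt_top
        (ENNReal.mul_lt_top hgx (ENNReal.add_lt_top.2
          ⟨ENNReal.mul_lt_top (hγ1.trans ENNReal.one_lt_top) hx, hCtop⟩))⟩
  have hIpow (n : ℕ) : I (n + 1) ≤ z ^ n * I 1 := by
    induction n with
    | zero => simp
    | succ n ih =>
      calc I (n + 1 + 1) ≤ z * I (n + 1) := hI _ (by omega)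
        _ ≤ z * (z ^ n * I 1) := mul_le_mul_right ih _
        _ = z ^ (n + 1) * I 1 := by ring
  have htail (n : ℕ) : Pr {ω | ∀ k ≤ n, δ k ω = false} ≤
      ENNReal.ofReal (((I 1).toReal + 1) * ζ ^ n) := by
    have hset : {ω | ∀ k ≤ n, δ k ω = false} = D (n + 1) := by
      simp [hD, noSuccessBefore]
    calc Pr {ω | ∀ k ≤ n, δ k ω = false} = ∫⁻ _ in D (n + 1), 1 ∂Pr := by
          rw [hset, setLIntegral_one]
      _ ≤ I (n + 1) := lintegral_mono fun _ => le_self_add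
      _ ≤ z ^ n * I 1 := hIpow n
      _ = ENNReal.ofReal ((I 1).toReal * ζ ^ n) := by
          rw [ENNReal.ofReal_mul ENNReal.toReal_nonneg, ENNReal.ofReal_toReal hI1,
            ENNReal.ofReal_pow hζ0.le, mul_comm]
      _ ≤ _ := ENNReal.ofReal_le_ofReal (by gcongr; linarith)
  refine ⟨(I 1).toReal + 1, ζ, by positivity, hζ0, hζ1, htail, ?_⟩
  have hlim : Tendsto (fun n : ℕ => ENNReal.ofReal (((I 1).toReal + 1) * ζ ^ n)) atTop
      (nhds 0) := by
    have := ENNReal.tendsto_ofReal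
      ((tendsto_pow_atTop_nhds_zero_of_lt_one hζ0.le hζ1).const_mul ((I 1).toReal + 1))
    simpa using this
  exact le_antisymm (ge_of_tendsto' hlim fun n =>
    (measure_mono fun ω (hω : ∀ k, δ k ω = false) => show ∀ k ≤ n, δ k ω = false from
      fun k _ => hω k).trans (htail n)) zero_le

end
end

section
/- Let K be a Markov kernel on a Polish space 𝒳, β∈(0,1), ν a probability measure, and C ⊆ 𝒳 a Borel set such that K(x,·) ≥ βν(·) for all x∈C. For a probability measure λ on 𝒳, define the split measure λ* on 𝒳×{0,1} by λ*(A×{0}) := (1−β)λ(A∩C) + λ(A∩Cᶜ) and λ*(A×{1}) := βλ(A∩C). Define the split kernel Ǩ on 𝒳×{0,1} by: Ǩ((x,0),·) := (K(x,·))* if x∉C; Ǩ((x,0),·) := ((K(x,·) − βν)/(1−β))* if x∈C; and Ǩ((x,1),·) := ν*. Then for every probability measure λ on 𝒳 and every Borel set A ⊆ 𝒳, ∫_{𝒳×{0,1}} Ǩ(z, A×{0,1}) λ*(dz) = ∫_𝒳 K(x, A) λ(dx); that is, one step of the split kernel from λ* has 𝒳-marginal equal to one step of K from λ. -/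
open MeasureTheory ProbabilityTheory
open scoped ENNReal

noncomputable section

attribute [local instance] Classical.propDecidable

/-- The splitting `μ*` of a (sub)probability measure `μ` on `𝒳`, as a measure on
`𝒳 × {0,1}` (with `Bool`, `false ↔ 0`, `true ↔ 1`):
`μ*(A×{0}) = (1−β)μ(A∩C) + μ(A∩Cᶜ)` and `μ*(A×{1}) = βμ(A∩C)`. -/
def splitMeasure {𝒳 : Type*} [MeasurableSpace 𝒳] (β : ℝ≥0∞) (C : Set 𝒳)
    (μ : Measure 𝒳) : Measure (𝒳 × Bool) :=
  Measure.map (fun x => (x, false)) ((1 - β) • μ.restrict C + μ.restrict Cᶜ)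
    + Measure.map (fun x => (x, true)) (β • μ.restrict C)

/-- The split kernel `Ǩ` on `𝒳 × {0,1}` associated with a kernel `K`, the
minorization constant `β`, the minorizing measure `ν` and the small set `C`:
`Ǩ((x,0),·) = (K(x,·))*` if `x ∉ C`, `Ǩ((x,0),·) = ((K(x,·) − βν)/(1−β))*` if
`x ∈ C`, and `Ǩ((x,1),·) = ν*`. -/
def splitKernel {𝒳 : Type*} [MeasurableSpace 𝒳] (K : Kernel 𝒳 𝒳) (β : ℝ≥0∞)
    (ν : Measure 𝒳) (C : Set 𝒳) : 𝒳 × Bool → Measure (𝒳 × Bool) :=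
  fun p =>
    if p.2 = true then splitMeasure β C ν
    else if p.1 ∈ C then splitMeasure β C ((1 - β)⁻¹ • (K p.1 - β • ν))
    else splitMeasure β C (K p.1)

/-- Integration against `μ*` splits over the two levels. -/
theorem lintegral_splitMeasure {𝒳 : Type*} [MeasurableSpace 𝒳] (β : ℝ≥0∞) (C : Set 𝒳)
    (μ : Measure 𝒳) (f : 𝒳 × Bool → ℝ≥0∞) :
    ∫⁻ z, f z ∂(splitMeasure β C μ)
      = (1 - β) * ∫⁻ x in C, f (x, false) ∂μ + ∫⁻ x in Cᶜ, f (x, false) ∂μ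
        + β * ∫⁻ x in C, f (x, true) ∂μ := by
  rw [splitMeasure, lintegral_add_measure, (measurableEmbedding_prod_mk_right false).lintegral_map,
    (measurableEmbedding_prod_mk_right true).lintegral_map, lintegral_add_measure,
    lintegral_smul_measure, lintegral_smul_measure, smul_eq_mul, smul_eq_mul]

/-- The `𝒳`-marginal of `μ*` is `μ`. -/
theorem splitMeasure_prod_univ {𝒳 : Type*} [MeasurableSpace 𝒳] {β : ℝ≥0∞} (hβ : β ≤ 1)
    {C : Set 𝒳} (hC : MeasurableSet C) (μ : Measure 𝒳) (A : Set 𝒳) :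
    splitMeasure β C μ (A ×ˢ (Set.univ : Set Bool)) = μ A := by
  have key (b : Bool) :
      (fun x : 𝒳 => (x, b)) ⁻¹' (A ×ˢ (Set.univ : Set Bool)) = A := by
    ext x
    simp
  rw [splitMeasure, Measure.add_apply, (measurableEmbedding_prod_mk_right false).map_apply,
    (measurableEmbedding_prod_mk_right true).map_apply, key, key, Measure.add_apply,
    Measure.smul_apply, Measure.smul_apply, smul_eq_mul, smul_eq_mul, add_right_comm,
    ← add_mul, tsub_add_cancel_of_le hβ, one_mul, ← Measure.add_apply,
    Measure.restrict_add_restrict_compl hC]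

/-- **One step of the split kernel has the correct `𝒳`-marginal:** for any initial
probability measure `μ₀`, starting the split kernel from `μ₀*` and projecting to `𝒳`
gives exactly one step of `K` from `μ₀`. -/
theorem splitKernel_marginal_step
    {𝒳 : Type*} [MeasurableSpace 𝒳] [TopologicalSpace 𝒳] [PolishSpace 𝒳] [BorelSpace 𝒳]
    (K : Kernel 𝒳 𝒳) (hK : IsMarkovKernel K)
    (β : ℝ≥0∞) (hβ0 : 0 < β) (hβ1 : β < 1)
    (ν : Measure 𝒳) (hν : IsProbabilityMeasure ν)
    (C : Set 𝒳) (hC : MeasurableSet C)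
    (hmin : ∀ x ∈ C, ∀ A : Set 𝒳, MeasurableSet A → β * ν A ≤ K x A)
    (μ₀ : Measure 𝒳) (hμ₀ : IsProbabilityMeasure μ₀)
    (A : Set 𝒳) (hA : MeasurableSet A) :
    ∫⁻ z, splitKernel K β ν C z (A ×ˢ (Set.univ : Set Bool)) ∂(splitMeasure β C μ₀)
      = ∫⁻ x, K x A ∂μ₀ := by
  have hβ : β ≠ ∞ := hβ1.ne_top
  have hβ' : 1 - β ≠ 0 := (tsub_pos_of_lt hβ1).ne'
  have hsub : 1 - β ≠ ∞ := ENNReal.sub_ne_top ENNReal.one_ne_top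
  have h_true (x : 𝒳) : splitKernel K β ν C (x, true) (A ×ˢ Set.univ) = ν A := by
    simp [-Bool.univ_eq, splitKernel, splitMeasure_prod_univ hβ1.le hC]
  have h_compl : ∀ x ∈ Cᶜ, splitKernel K β ν C (x, false) (A ×ˢ Set.univ) = K x A := by
    intro x hx
    rw [Set.mem_compl_iff] at hx
    simp [-Bool.univ_eq, splitKernel, hx, splitMeasure_prod_univ hβ1.le hC]
  have h_mem : ∀ x ∈ C, splitKernel K β ν C (x, false) (A ×ˢ Set.univ)
      = (1 - β)⁻¹ * (K x A - β * ν A) := by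
    intro x hx
    have : IsFiniteMeasure (β • ν) := Measure.smul_finite ν hβ
    have hle : β • ν ≤ K x := Measure.le_iff.2 (hmin x hx)
    simp [-Bool.univ_eq, splitKernel, hx, splitMeasure_prod_univ hβ1.le hC, Measure.sub_apply hA hle]
  rw [lintegral_splitMeasure, setLIntegral_congr_fun hC h_mem,
    setLIntegral_congr_fun hC.compl h_compl, setLIntegral_congr_fun hC fun x _ => h_true x,
    lintegral_const_mul' _ _ (ENNReal.inv_ne_top.2 hβ'), ← mul_assoc,
    ENNReal.mul_inv_cancel hβ' hsub, one_mul, ← lintegral_const_mul' _ _ hβ, add_right_comm,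
    ← lintegral_add_right _ measurable_const,
    setLIntegral_congr_fun hC fun x hx => tsub_add_cancel_of_le (hmin x hx A hA),
    lintegral_add_compl _ hC]

end
end
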